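/- Parseval identity on slices for quaternionic power series: let c : ℕ → ℍ satisfy ∑_{n≥0} ‖c_n‖² < ∞ and let f(q) = ∑_{n≥0} qⁿ·c_n for q in the open unit ball 𝔹 of ℍ. Then for every imaginary unit I and every r with 0 ≤ r < 1, (1/(2π))·∫₀^{2π} ‖f(r·e^{Iθ})‖² dθ = ∑_{n≥0} r^{2n}·‖c_n‖², and consequently lim_{r→1⁻} (1/(2π))·∫₀^{2π} ‖f(r·e^{Iθ})‖² dθ = ∑_{n≥0} ‖c_n‖², independently of I. (Thus the square of the H²(𝔹)-norm of f equals ∑_{n≥0} ‖c_n‖².) -/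

import Mathlib

open scoped Real
noncomputable section

/-- `e^{Iθ} = cos θ + (sin θ)•I`. -/
def expI (I : Quaternion ℝ) (θ : ℝ) : Quaternion ℝ :=
  (Real.cos θ : Quaternion ℝ) + Real.sin θ • I

lemma expI_zero (I : Quaternion ℝ) : expI I 0 = 1 := by
  simp [expI]

lemma expI_add {I : Quaternion ℝ} (hI : I ^ 2 = -1) (s t : ℝ) :
    expI I (s + t) = expI I s * expI I t := by
  have h : I * I = ((-1 : ℝ) : Quaternion ℝ) := by rw [← sq, hI]; simp
  simp only [expI, Real.cos_add, Real.sin_add, mul_add, add_mul, smul_mul_assoc,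
    mul_smul_comm, h, Quaternion.coe_mul_eq_smul, Quaternion.mul_coe_eq_smul,
    ← Quaternion.coe_smul]
  ext <;> simp <;> ring

lemma expI_pow {I : Quaternion ℝ} (hI : I ^ 2 = -1) (t : ℝ) (n : ℕ) :
    expI I t ^ n = expI I (n * t) := by
  induction n with
  | zero => simp [expI_zero]
  | succ k ih => rw [pow_succ, ih, ← expI_add hI]; push_cast; ring_nf

lemma norm_eq_one_of_sq_eq_neg_one {I : Quaternion ℝ} (hI : I ^ 2 = -1) : ‖I‖ = 1 := by
  have h : ‖I‖ ^ 2 = 1 := by rw [← norm_pow, hI, norm_neg, norm_one]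
  exact (pow_eq_one_iff_of_nonneg (norm_nonneg I) two_ne_zero).1 h

lemma star_eq_neg_of_sq_eq_neg_one {I : Quaternion ℝ} (hI : I ^ 2 = -1) : star I = -I := by
  have h : I * star I = 1 := by
    rw [Quaternion.self_mul_star, Quaternion.normSq_eq_norm_mul_self,
      norm_eq_one_of_sq_eq_neg_one hI]
    simp
  calc star I = -(I ^ 2 * star I) := by rw [hI]; simp
    _ = -I := by rw [sq, mul_assoc, h, mul_one]

lemma star_expI {I : Quaternion ℝ} (hI : I ^ 2 = -1) (t : ℝ) :
    star (expI I t) = expI I (-t) := by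
  simp [expI, star_eq_neg_of_sq_eq_neg_one hI]

lemma norm_expI {I : Quaternion ℝ} (hI : I ^ 2 = -1) (t : ℝ) : ‖expI I t‖ = 1 := by
  have h : ‖expI I t‖ * ‖expI I t‖ = 1 := by
    calc ‖expI I t‖ * ‖expI I t‖ = ‖star (expI I t) * expI I t‖ := by rw [norm_mul, norm_star]
      _ = 1 := by rw [star_expI hI, ← expI_add hI, neg_add_cancel, expI_zero, norm_one]
  nlinarith [norm_nonneg (expI I t)]

lemma continuous_expI (I : Quaternion ℝ) : Continuous (expI I) := by
  unfold expI
  exact (Quaternion.continuous_coe.comp Real.continuous_cos).add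
    (Real.continuous_sin.smul continuous_const)

lemma re_mul_comm (a b : Quaternion ℝ) : (a * b).re = (b * a).re := by
  simp only [Quaternion.re_mul]; ring

lemma norm_sq_eq_re_mul_star (a : Quaternion ℝ) : ‖a‖ ^ 2 = (a * star a).re := by
  rw [Quaternion.self_mul_star, Quaternion.normSq_eq_norm_mul_self, Quaternion.re_coe, sq]

lemma abs_re_le_norm (a : Quaternion ℝ) : |a.re| ≤ ‖a‖ := by
  have h := norm_sq_eq_re_mul_star a
  apply abs_le_of_sq_le_sq _ (norm_nonneg a)
  simp at h
  nlinarith [sq_nonneg a.imI, sq_nonneg a.imJ, sq_nonneg a.imK]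

lemma hasSum_re {ι : Type*} {g : ι → Quaternion ℝ} {a : Quaternion ℝ} (h : HasSum g a) :
    HasSum (fun i => (g i).re) a.re :=
  h.map (⟨⟨fun q => q.re, rfl⟩, fun _ _ => rfl⟩ : Quaternion ℝ →+ ℝ) Quaternion.continuous_re

/-- The `(n, m)` cross term in the expansion of the squared norm of a power series on a slice. -/
lemma re_cross_term {I : Quaternion ℝ} (hI : I ^ 2 = -1) (a b : Quaternion ℝ) (r t : ℝ)
    (n m : ℕ) :
    (((r • expI I t) ^ n * a) * star ((r • expI I t) ^ m * b)).re =
      r ^ (n + m) * (Real.cos (((n : ℝ) - m) * t) * (a * star b).re +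
        Real.sin (((n : ℝ) - m) * t) * (I * (a * star b)).re) := by
  have h : expI I (((n : ℝ) - m) * t) = expI I (-(m * t)) * expI I (n * t) := by
    rw [← expI_add hI]; ring_nf
  have h2 : (((r • expI I t) ^ n * a) * star ((r • expI I t) ^ m * b)).re =
      r ^ (n + m) * (expI I (((n : ℝ) - m) * t) * (a * star b)).re := by
    rw [smul_pow, smul_pow, expI_pow hI, expI_pow hI, star_mul, Quaternion.star_smul, star_expI hI, h,
      mul_assoc (expI I (-(m * t))), re_mul_comm (expI I (-(m * t)))]
    simp only [smul_mul_assoc, mul_smul_comm, smul_smul, Quaternion.re_smul, mul_assoc,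
      smul_eq_mul]
    ring
  rw [h2, expI, add_mul, Quaternion.re_add, smul_mul_assoc, Quaternion.re_smul,
    Quaternion.coe_mul_eq_smul, Quaternion.re_smul, smul_eq_mul, smul_eq_mul]

lemma integral_cos_int_mul {k : ℤ} (hk : k ≠ 0) :
    ∫ t in (0 : ℝ)..(2 * π), Real.cos (k * t) = 0 := by
  have hk' : (k : ℝ) ≠ 0 := by exact_mod_cast hk
  have h := Real.sin_int_mul_pi (2 * k)
  push_cast at h
  rw [intervalIntegral.integral_comp_mul_left _ hk', integral_cos,
    show (k : ℝ) * (2 * π) = 2 * k * π by ring, h]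
  simp

lemma integral_sin_int_mul (k : ℤ) :
    ∫ t in (0 : ℝ)..(2 * π), Real.sin (k * t) = 0 := by
  rcases eq_or_ne k 0 with rfl | hk
  · simp
  have hk' : (k : ℝ) ≠ 0 := by exact_mod_cast hk
  rw [intervalIntegral.integral_comp_mul_left _ hk', integral_sin, Real.cos_int_mul_two_pi]
  simp

lemma integral_re_cross_term {I : Quaternion ℝ} (hI : I ^ 2 = -1) (a b : Quaternion ℝ) (r : ℝ)
    {n m : ℕ} (hnm : n ≠ m) :
    ∫ t in (0 : ℝ)..(2 * π),
      (((r • expI I t) ^ n * a) * star ((r • expI I t) ^ m * b)).re = 0 := by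
  have hk : (n : ℤ) - m ≠ 0 := sub_ne_zero.2 (by exact_mod_cast hnm)
  have hc := integral_cos_int_mul hk
  have hs := integral_sin_int_mul ((n : ℤ) - m)
  push_cast at hc hs
  simp only [re_cross_term hI]
  rw [intervalIntegral.integral_const_mul, intervalIntegral.integral_add,
    intervalIntegral.integral_mul_const, intervalIntegral.integral_mul_const, hc, hs]
  · simp
  · exact (by fun_prop : Continuous _).intervalIntegrable _ _
  · exact (by fun_prop : Continuous _).intervalIntegrable _ _

lemma summable_pow_mul_norm {c : ℕ → Quaternion ℝ} (hc : Summable (fun n => ‖c n‖ ^ 2))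
    {r : ℝ} (hr0 : 0 ≤ r) (hr1 : r < 1) : Summable (fun n => r ^ n * ‖c n‖) := by
  refine Summable.of_nonneg_of_le (fun n => by positivity) (fun n => ?_)
    ((summable_geometric_of_lt_one hr0 hr1).add hc)
  have h0 : 0 ≤ r ^ n := by positivity
  have h1 : r ^ n ≤ 1 := pow_le_one₀ hr0 hr1.le
  nlinarith [sq_nonneg (r ^ n - ‖c n‖), norm_nonneg (c n)]

lemma hasSum_integral_norm_sq {c : ℕ → Quaternion ℝ} (hc : Summable (fun n => ‖c n‖ ^ 2))
    {I : Quaternion ℝ} (hI : I ^ 2 = -1) {r : ℝ} (hr0 : 0 ≤ r) (hr1 : r < 1) :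
    HasSum (fun n : ℕ => 2 * π * (r ^ (2 * n) * ‖c n‖ ^ 2))
      (∫ t in (0 : ℝ)..(2 * π), ‖∑' n : ℕ, (r • expI I t) ^ n * c n‖ ^ 2) := by
  have hs := summable_pow_mul_norm hc hr0 hr1
  have hnorm (t : ℝ) (n : ℕ) : ‖(r • expI I t) ^ n * c n‖ = r ^ n * ‖c n‖ := by
    rw [norm_mul, norm_pow, norm_smul, norm_expI hI, mul_one, Real.norm_of_nonneg hr0]
  have hnorm' (t : ℝ) (n : ℕ) : ‖star ((r • expI I t) ^ n * c n)‖ = r ^ n * ‖c n‖ := by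
    rw [norm_star, hnorm]
  have hbound : Summable (fun p : ℕ × ℕ => (r ^ p.1 * ‖c p.1‖) * (r ^ p.2 * ‖c p.2‖)) :=
    hs.mul_of_nonneg hs (fun n => by positivity) (fun n => by positivity)
  have hdouble : HasSum
      (fun p : ℕ × ℕ => ∫ t in (0 : ℝ)..(2 * π),
        (((r • expI I t) ^ p.1 * c p.1) * star ((r • expI I t) ^ p.2 * c p.2)).re)
      (∫ t in (0 : ℝ)..(2 * π), ‖∑' n : ℕ, (r • expI I t) ^ n * c n‖ ^ 2) := by
    refine intervalIntegral.hasSum_integral_of_dominated_convergence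
      (fun p _ => (r ^ p.1 * ‖c p.1‖) * (r ^ p.2 * ‖c p.2‖)) (fun p => ?_) (fun p => ?_)
      (Filter.Eventually.of_forall fun _ _ => hbound) ?_ (Filter.Eventually.of_forall fun t _ => ?_)
    · have := continuous_expI I
      have hre := Quaternion.continuous_re
      exact (by fun_prop : Continuous _).aestronglyMeasurable
    · refine Filter.Eventually.of_forall fun t _ => ?_
      rw [← hnorm t p.1, ← hnorm' t p.2, ← norm_mul]
      exact abs_re_le_norm _
    · exact intervalIntegrable_const
    · have h1 : Summable (fun n => ‖(r • expI I t) ^ n * c n‖) := by simpa only [hnorm] using hs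
      have h2 : Summable (fun n => ‖star ((r • expI I t) ^ n * c n)‖) := by
        simpa only [hnorm'] using hs
      rw [norm_sq_eq_re_mul_star, tsum_star, tsum_mul_tsum_of_summable_norm h1 h2]
      exact hasSum_re (summable_mul_of_summable_norm h1 h2).hasSum
  have hinj : Function.Injective (fun n : ℕ => (n, n)) := fun a b h => (Prod.ext_iff.1 h).1
  rw [← hinj.hasSum_iff] at hdouble
  · convert hdouble using 2 with n
    simp only [Function.comp_apply, ← norm_sq_eq_re_mul_star, hnorm]
    rw [intervalIntegral.integral_const, smul_eq_mul]
    ring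
  · rintro ⟨n, m⟩ hnm
    exact integral_re_cross_term hI _ _ r fun h => hnm ⟨n, Prod.ext rfl h⟩

/-- **Parseval identity on slices** for quaternionic power series: for
`f(q) = ∑ qⁿ c_n` with `∑ ‖c_n‖² < ∞`, every imaginary unit `I` and `0 ≤ r < 1`,
`(1/(2π))·∫₀^{2π} ‖f(r·e^{Iθ})‖² dθ = ∑ r^{2n} ‖c_n‖²`, and the limit as `r → 1⁻`
is `∑ ‖c_n‖²`, independently of `I`. -/
theorem parseval_on_slices
    (c : ℕ → Quaternion ℝ) (hc : Summable (fun n => ‖c n‖ ^ 2))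
    (f : Quaternion ℝ → Quaternion ℝ)
    (hf : ∀ q : Quaternion ℝ, ‖q‖ < 1 → f q = ∑' n : ℕ, q ^ n * c n)
    (I : Quaternion ℝ) (hI : I ^ 2 = -1) :
    (∀ r : ℝ, 0 ≤ r → r < 1 →
      (1 / (2 * π)) * ∫ θ in (0:ℝ)..(2 * π), ‖f (r • expI I θ)‖ ^ 2 =
        ∑' n : ℕ, r ^ (2 * n) * ‖c n‖ ^ 2) ∧
    Filter.Tendsto (fun r : ℝ =>
        (1 / (2 * π)) * ∫ θ in (0:ℝ)..(2 * π), ‖f (r • expI I θ)‖ ^ 2)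
      (nhdsWithin 1 (Set.Iio 1)) (nhds (∑' n : ℕ, ‖c n‖ ^ 2)) := by
  have key : ∀ r : ℝ, 0 ≤ r → r < 1 →
      (1 / (2 * π)) * ∫ θ in (0:ℝ)..(2 * π), ‖f (r • expI I θ)‖ ^ 2 =
        ∑' n : ℕ, r ^ (2 * n) * ‖c n‖ ^ 2 := by
    intro r hr0 hr1
    have hfr (t : ℝ) : f (r • expI I t) = ∑' n : ℕ, (r • expI I t) ^ n * c n :=
      hf _ (by rwa [norm_smul, norm_expI hI, mul_one, Real.norm_of_nonneg hr0])
    simp only [hfr]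
    rw [← (hasSum_integral_norm_sq hc hI hr0 hr1).tsum_eq, tsum_mul_left, ← mul_assoc,
      one_div_mul_cancel (by positivity), one_mul]
  refine ⟨key, ?_⟩
  have hmem : ∀ᶠ r : ℝ in nhdsWithin 1 (Set.Iio 1), r ∈ Set.Ioo (0 : ℝ) 1 :=
    Ioo_mem_nhdsLT one_pos
  have hlim : Filter.Tendsto (fun r : ℝ => ∑' n : ℕ, r ^ (2 * n) * ‖c n‖ ^ 2)
      (nhdsWithin 1 (Set.Iio 1)) (nhds (∑' n : ℕ, ‖c n‖ ^ 2)) := by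
    refine tendsto_tsum_of_dominated_convergence hc (fun n => ?_) ?_
    · have h : Continuous fun r : ℝ => r ^ (2 * n) * ‖c n‖ ^ 2 := by fun_prop
      simpa using (h.tendsto 1).mono_left nhdsWithin_le_nhds
    · filter_upwards [hmem] with r hr n
      rw [Real.norm_of_nonneg (mul_nonneg (pow_nonneg hr.1.le _) (sq_nonneg _))]
      exact mul_le_of_le_one_left (sq_nonneg _) (pow_le_one₀ hr.1.le hr.2.le)
  refine hlim.congr' ?_
  filter_upwards [hmem] with r hr
  exact (key r hr.1.le hr.2).symm
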